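/- arXiv:1906.08429 — 4 statements merged into one kernel-verified Lean document; each statement's English description precedes it below -/
import Mathlib

section
/- Let G be a group equipped with a bi-invariant metric d (i.e., d(kg, kh) = d(g, h) = d(gk, hk) for all g, h, k in G) satisfying the chain-decomposition property: for every h in G and every δ > 0 there exist N ∈ ℕ and elements h_1, …, h_N of G with h = h_1 · … · h_N, d(h_i, 1) ≤ δ for every i, and N ≤ d(h, 1)/δ + 2. Let r : G → ℝ be a homogeneous quasimorphism. Then r is Lipschitz with respect to d if and only if r is continuous at the identity element of G. -/
/-- A bound that holds after scaling by every `n`, up to a fixed additive error, holds exactly. -/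
theorem le_of_forall_nat_mul_le_add {x y c : ℝ} (h : ∀ n : ℕ, n * x ≤ n * y + c) : x ≤ y := by
  by_contra! hxy
  obtain ⟨n, hn⟩ := exists_nat_gt (c / (x - y))
  rw [div_lt_iff₀ (sub_pos.mpr hxy)] at hn
  linarith [h n]

/-- In a group with a bi-invariant metric, `n`-th powers diverge at most linearly in `n`. -/
theorem dist_pow_pow_le_of_biinvariant {G : Type*} [Group G] [PseudoMetricSpace G]
    (hleft : ∀ k g h : G, dist (k * g) (k * h) = dist g h)
    (hright : ∀ g h k : G, dist (g * k) (h * k) = dist g h) (g h : G) (n : ℕ) :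
    dist (g ^ n) (h ^ n) ≤ n * dist g h := by
  induction n with
  | zero => simp
  | succ n ih =>
    have htri := dist_triangle (g ^ n * g) (h ^ n * g) (h ^ n * h)
    rw [hright, hleft] at htri
    rw [pow_succ, pow_succ]
    push_cast
    linarith

/-- A quasimorphism of defect `D` that is bounded by `ε` on the factors of a product is bounded
on the product by the number of factors times `ε + D`. -/
theorem abs_quasimorphism_list_prod_le {G : Type*} [Monoid G] {r : G → ℝ} {D ε : ℝ}
    (hD : ∀ f g : G, |r (f * g) - r f - r g| ≤ D) (h1 : r 1 = 0) (l : List G)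
    (hl : ∀ g ∈ l, |r g| ≤ ε) : |r l.prod| ≤ l.length * (ε + D) := by
  induction l with
  | nil => simp [h1]
  | cons a l ih =>
    have ha := abs_le.mp (hl a List.mem_cons_self)
    have ih' := abs_le.mp (ih fun g hg => hl g (List.mem_cons_of_mem a hg))
    have hq := abs_le.mp (hD a l.prod)
    rw [List.prod_cons, List.length_cons, abs_le]
    push_cast
    constructor <;> linarith

/-- Let `G` be a group with a bi-invariant metric satisfying the chain-decomposition
property. A homogeneous quasimorphism `r : G → ℝ` is Lipschitz with respect to the metric
if and only if it is continuous at the identity. -/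
theorem homogeneous_quasimorphism_lipschitz_iff_continuous_at_one
    {G : Type*} [Group G] [MetricSpace G]
    (hleft : ∀ k g h : G, dist (k * g) (k * h) = dist g h)
    (hright : ∀ g h k : G, dist (g * k) (h * k) = dist g h)
    (hchain : ∀ h : G, ∀ δ : ℝ, 0 < δ →
      ∃ (N : ℕ) (c : Fin N → G), h = (List.ofFn c).prod ∧
        (∀ i, dist (c i) 1 ≤ δ) ∧ (N : ℝ) ≤ dist h 1 / δ + 2)
    (r : G → ℝ)
    (hquasi : ∃ D : ℝ, 0 ≤ D ∧ ∀ f g : G, |r (f * g) - r f - r g| ≤ D)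
    (hhom : ∀ (g : G) (m : ℤ), r (g ^ m) = m * r g) :
    (∃ C : ℝ, 0 ≤ C ∧ ∀ g h : G, |r g - r h| ≤ C * dist g h) ↔
      (∀ ε : ℝ, 0 < ε → ∃ δ : ℝ, 0 < δ ∧ ∀ g : G, dist g 1 ≤ δ → |r g| ≤ ε) := by
  have h1 : r 1 = 0 := by simpa using hhom 1 0
  constructor
  · rintro ⟨C, hC, hLip⟩ ε hε
    refine ⟨ε / (C + 1), by positivity, fun g hg => ?_⟩
    have hb := hLip g 1
    rw [h1, sub_zero] at hb
    rw [le_div_iff₀ (by positivity)] at hg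
    linarith [dist_nonneg (x := g) (y := 1)]
  · intro hcont
    obtain ⟨D, hD0, hD⟩ := hquasi
    obtain ⟨δ, hδ, hsmall⟩ := hcont 1 one_pos
    refine ⟨(1 + D) / δ, by positivity, fun g h => ?_⟩
    refine le_of_forall_nat_mul_le_add (c := D + 2 * (1 + D)) fun n => ?_
    obtain ⟨N, c, hprod, hc, hN⟩ := hchain ((h ^ n)⁻¹ * g ^ n) δ hδ
    have hdist : dist ((h ^ n)⁻¹ * g ^ n) 1 ≤ n * dist g h := by
      rw [← hleft (h ^ n), mul_inv_cancel_left, mul_one]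
      exact dist_pow_pow_le_of_biinvariant hleft hright g h n
    have hquot : |r ((h ^ n)⁻¹ * g ^ n)| ≤ N * (1 + D) := by
      have hb := abs_quasimorphism_list_prod_le hD h1 (List.ofFn c)
        (List.forall_mem_ofFn_iff.mpr fun i => hsmall _ (hc i))
      rwa [← hprod, List.length_ofFn] at hb
    have hcount : N * (1 + D) ≤ (n * dist g h / δ + 2) * (1 + D) := by
      gcongr
      exact hN.trans (by gcongr)
    have hq := hD (h ^ n) ((h ^ n)⁻¹ * g ^ n)
    have hg := hhom g n
    have hh := hhom h n
    simp only [zpow_natCast, Int.cast_natCast] at hg hh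
    rw [mul_inv_cancel_left, hg, hh] at hq
    calc n * |r g - r h| = |n * r g - n * r h| := by
          rw [← mul_sub, abs_mul, Nat.abs_cast]
      _ ≤ |n * r g - n * r h - r ((h ^ n)⁻¹ * g ^ n)| + |r ((h ^ n)⁻¹ * g ^ n)| := by
          simpa using abs_add_le (n * r g - n * r h - r ((h ^ n)⁻¹ * g ^ n))
            (r ((h ^ n)⁻¹ * g ^ n))
      _ ≤ D + (n * dist g h / δ + 2) * (1 + D) := add_le_add hq (hquot.trans hcount)
      _ = n * ((1 + D) / δ * dist g h) + (D + 2 * (1 + D)) := by ring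
end

section
/- Let G be a group with a metric d satisfying the chain-decomposition property: for every h in G and every δ > 0 there exist N ∈ ℕ and elements h_1, …, h_N of G with h = h_1 · … · h_N, d(h_i, 1) ≤ δ for every i, and N ≤ d(h, 1)/δ + 2. Let r : G → ℝ be a quasimorphism with defect D, and suppose ε > 0 and δ > 0 are such that every g ∈ G with d(g, 1) ≤ δ satisfies |r(g)| ≤ ε. Then every h ∈ G satisfies |r(h)| ≤ (d(h, 1)/δ + 2)·(ε + D). -/
/-- A quasimorphism of defect `D` bounded by `ε` on the entries of a nonempty list with `n + 1`
entries is bounded by `(n + 1) * ε + n * D` on its product. -/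
theorem abs_quasimorphism_list_prod_cons_le {M : Type*} [Monoid M] {r : M → ℝ} {D ε : ℝ}
    (hD : ∀ f g : M, |r (f * g) - r f - r g| ≤ D) (a : M) (l : List M)
    (hl : ∀ x ∈ a :: l, |r x| ≤ ε) :
    |r (a :: l).prod| ≤ (l.length + 1) * ε + l.length * D := by
  induction l generalizing a with
  | nil => simpa using hl
  | cons b l ih =>
    have htail := abs_le.mp (ih b fun x hx => hl x (List.mem_cons_of_mem a hx))
    have ha := abs_le.mp (hl a List.mem_cons_self)
    have hdef := abs_le.mp (hD a (b :: l).prod)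
    rw [List.prod_cons, List.length_cons, abs_le]
    push_cast
    constructor <;> linarith

/-- If a metric on a group satisfies the chain-decomposition property and a
quasimorphism `r` with defect `D` is bounded by `ε` on the `δ`-ball around the
identity, then `|r(h)| ≤ (d(h,1)/δ + 2)·(ε + D)` for every `h`. -/
theorem abs_quasimorphism_le_of_chain_decomposition
    {G : Type*} [Group G] [MetricSpace G]
    (hchain : ∀ h : G, ∀ δ : ℝ, 0 < δ →
      ∃ (N : ℕ) (c : Fin N → G), h = (List.ofFn c).prod ∧
        (∀ i, dist (c i) 1 ≤ δ) ∧ (N : ℝ) ≤ dist h 1 / δ + 2)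
    (r : G → ℝ) (D : ℝ) (hD0 : 0 ≤ D)
    (hD : ∀ f g : G, |r (f * g) - r f - r g| ≤ D)
    (ε δ : ℝ) (hε : 0 < ε) (hδ : 0 < δ)
    (hsmall : ∀ g : G, dist g 1 ≤ δ → |r g| ≤ ε) :
    ∀ h : G, |r h| ≤ (dist h 1 / δ + 2) * (ε + D) := by
  intro h
  obtain ⟨N, c, hprod, hc, hN⟩ := hchain h δ hδ
  have hr : |r h| ≤ max 1 (N : ℝ) * (ε + D) := by
    cases N with
    | zero =>
      have hone : |r 1| ≤ ε := hsmall 1 (by simpa using hδ.le)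
      simp only [List.ofFn_zero, List.prod_nil] at hprod
      simp only [hprod, Nat.cast_zero, zero_le_one, max_eq_left, one_mul]
      linarith
    | succ n =>
      rw [List.ofFn_succ] at hprod
      have hbound := abs_quasimorphism_list_prod_cons_le (ε := ε) hD (c 0)
        (List.ofFn fun i : Fin n => c i.succ) (by
          rw [← List.ofFn_succ, List.forall_mem_ofFn_iff]
          exact fun i => hsmall _ (hc i))
      rw [← hprod, List.length_ofFn] at hbound
      rw [max_eq_right (by simp)]
      push_cast
      linarith
  refine hr.trans (mul_le_mul_of_nonneg_right (max_le ?_ hN) (by positivity))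
  have : 0 ≤ dist h 1 / δ := by positivity
  linarith
end

section
/- Let G be a group with a bi-invariant metric d (i.e., d(kg, kh) = d(g, h) = d(gk, hk) for all g, h, k ∈ G) satisfying the chain-decomposition property: for every h in G and every δ > 0 there exist N ∈ ℕ and elements h_1, …, h_N of G with h = h_1 · … · h_N, d(h_i, 1) ≤ δ for every i, and N ≤ d(h, 1)/δ + 2. Let r : G → ℝ be a quasimorphism with defect D, and suppose ε > 0 and δ > 0 are such that every g ∈ G with d(g, 1) ≤ δ satisfies |r(g)| ≤ ε. Then for all g, h ∈ G with d(h, 1) ≥ δ, one has |r(hg) − r(g)| ≤ d(hg, g) · (3·(ε + D) + D)/δ. -/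
/-- Left multiplication by a product of elements on which a quasimorphism of defect `D` is
bounded by `ε` changes its value by at most `ε + D` per factor. -/
lemma abs_quasimorphism_list_prod_mul_sub_le {M : Type*} [Monoid M] {r : M → ℝ} {D ε : ℝ}
    (hD : ∀ f g : M, |r (f * g) - r f - r g| ≤ D) (l : List M) (hl : ∀ x ∈ l, |r x| ≤ ε) (g : M) :
    |r (l.prod * g) - r g| ≤ l.length * (ε + D) := by
  induction l with
  | nil => simp
  | cons a l ih =>
    have ih' := abs_le.mp (ih fun x hx => hl x (List.mem_cons_of_mem a hx))
    have ha := abs_le.mp (hl a List.mem_cons_self)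
    have hq := abs_le.mp (hD a (l.prod * g))
    rw [List.prod_cons, mul_assoc, List.length_cons, abs_le]
    push_cast
    constructor <;> linarith

/-- Large-scale Lipschitz property: for a bi-invariant metric with the
chain-decomposition property and a quasimorphism `r` with defect `D` bounded by `ε`
on the `δ`-ball around the identity, for all `g, h` with `d(h,1) ≥ δ` one has
`|r(hg) − r(g)| ≤ d(hg, g) · (3(ε + D) + D)/δ`. -/
theorem quasimorphism_large_scale_lipschitz
    {G : Type*} [Group G] [MetricSpace G]
    (hleft : ∀ k g h : G, dist (k * g) (k * h) = dist g h)
    (hright : ∀ g h k : G, dist (g * k) (h * k) = dist g h)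
    (hchain : ∀ h : G, ∀ δ : ℝ, 0 < δ →
      ∃ (N : ℕ) (c : Fin N → G), h = (List.ofFn c).prod ∧
        (∀ i, dist (c i) 1 ≤ δ) ∧ (N : ℝ) ≤ dist h 1 / δ + 2)
    (r : G → ℝ) (D : ℝ) (hD0 : 0 ≤ D)
    (hD : ∀ f g : G, |r (f * g) - r f - r g| ≤ D)
    (ε δ : ℝ) (hε : 0 < ε) (hδ : 0 < δ)
    (hsmall : ∀ g : G, dist g 1 ≤ δ → |r g| ≤ ε) :
    ∀ g h : G, δ ≤ dist h 1 →
      |r (h * g) - r g| ≤ dist (h * g) g * (3 * (ε + D) + D) / δ := by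
  intro g h hh
  obtain ⟨N, c, rfl, hc, hN⟩ := hchain h δ hδ
  have hdist : dist ((List.ofFn c).prod * g) g = dist (List.ofFn c).prod 1 := by
    simpa using hright (List.ofFn c).prod 1 g
  have hr := abs_quasimorphism_list_prod_mul_sub_le hD (List.ofFn c)
    (by simpa [List.mem_ofFn] using fun i => hsmall _ (hc i)) g
  rw [List.length_ofFn] at hr
  rw [hdist, mul_div_right_comm]
  have hone : 1 ≤ dist (List.ofFn c).prod 1 / δ := (one_le_div hδ).mpr hh
  calc
    _ ≤ (N : ℝ) * (ε + D) := hr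
    _ ≤ (3 * (dist (List.ofFn c).prod 1 / δ)) * (ε + D) := by gcongr; linarith
    _ = dist (List.ofFn c).prod 1 / δ * (3 * (ε + D)) := by ring
    _ ≤ _ := by gcongr; linarith
end

section
/- Let G be a group with a bi-invariant metric d (i.e., d(kg, kh) = d(g, h) = d(gk, hk) for all g, h, k ∈ G). Let r : G → ℝ be a homogeneous quasimorphism with defect D, and suppose ε > 0 and δ > 0 are such that every f ∈ G with d(f, 1) ≤ δ satisfies |r(f)| ≤ ε. Then for all g, h ∈ G with 0 < d(h, 1) ≤ δ, one has |r(hg) − r(g)| ≤ (2/δ)·(ε + D)·d(hg, g). -/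
/-- For a bi-invariant metric, the `n`-th power map is `n`-Lipschitz. -/
theorem dist_pow_le_of_bi_invariant {G : Type*} [Group G] [MetricSpace G]
    (hleft : ∀ k g h : G, dist (k * g) (k * h) = dist g h)
    (hright : ∀ g h k : G, dist (g * k) (h * k) = dist g h)
    (a b : G) (n : ℕ) : dist (a ^ n) (b ^ n) ≤ n * dist a b := by
  induction n with
  | zero => simp
  | succ n ih =>
    calc dist (a ^ (n + 1)) (b ^ (n + 1))
        ≤ dist (a ^ n * a) (b ^ n * a) + dist (b ^ n * a) (b ^ n * b) := by
          rw [pow_succ, pow_succ]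
          exact dist_triangle _ _ _
      _ ≤ n * dist a b + dist a b := by
          rw [hright, hleft]
          gcongr
      _ = ((n + 1 : ℕ) : ℝ) * dist a b := by
          push_cast
          ring


/-- Local Lipschitz property: for a bi-invariant metric on a group and a homogeneous
quasimorphism `r` with defect `D` bounded by `ε` on the `δ`-ball around the identity,
for all `g, h` with `0 < d(h,1) ≤ δ` one has
`|r(hg) − r(g)| ≤ (2/δ)·(ε + D)·d(hg, g)`. -/
theorem quasimorphism_local_lipschitz
    {G : Type*} [Group G] [MetricSpace G]
    (hleft : ∀ k g h : G, dist (k * g) (k * h) = dist g h)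
    (hright : ∀ g h k : G, dist (g * k) (h * k) = dist g h)
    (r : G → ℝ) (D : ℝ) (hD0 : 0 ≤ D)
    (hD : ∀ f g : G, |r (f * g) - r f - r g| ≤ D)
    (hhom : ∀ (g : G) (m : ℤ), r (g ^ m) = m * r g)
    (ε δ : ℝ) (hε : 0 < ε) (hδ : 0 < δ)
    (hsmall : ∀ f : G, dist f 1 ≤ δ → |r f| ≤ ε) :
    ∀ g h : G, 0 < dist h 1 → dist h 1 ≤ δ →
      |r (h * g) - r g| ≤ (2 / δ) * (ε + D) * dist (h * g) g := by
  intro g h hpos hle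
  have hdist : dist (h * g) g = dist h 1 := by simpa using hright h 1 g
  rw [hdist]
  set p : ℕ := ⌊δ / dist h 1⌋₊
  have hp_one : 1 ≤ p := Nat.le_floor (by rw [Nat.cast_one, one_le_div hpos]; exact hle)
  have hp_one' : (1 : ℝ) ≤ p := by exact_mod_cast hp_one
  have hp_le : p * dist h 1 ≤ δ := (le_div_iff₀ hpos).1 (Nat.floor_le (by positivity))
  have hp_lt : δ < (p + 1) * dist h 1 := (div_lt_iff₀ hpos).1 (Nat.lt_floor_add_one _)
  have hp_two : δ ≤ 2 * p * dist h 1 := by nlinarith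
  have hf : |r ((h * g) ^ p * (g ^ p)⁻¹)| ≤ ε := by
    apply hsmall
    calc dist ((h * g) ^ p * (g ^ p)⁻¹) 1 = dist ((h * g) ^ p) (g ^ p) := by
          simpa using hright ((h * g) ^ p) (g ^ p) (g ^ p)⁻¹
      _ ≤ p * dist (h * g) g := dist_pow_le_of_bi_invariant hleft hright _ _ _
      _ ≤ δ := by rwa [hdist]
  have hpow (x : G) : r (x ^ p) = p * r x := by simpa using hhom x p
  have hdef := hD ((h * g) ^ p * (g ^ p)⁻¹) (g ^ p)
  rw [inv_mul_cancel_right, hpow, hpow] at hdef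
  have hbound : p * |r (h * g) - r g| ≤ ε + D := by
    rw [← abs_of_nonneg (Nat.cast_nonneg (α := ℝ) p), ← abs_mul, abs_le]
    rw [abs_le] at hf hdef
    constructor <;> linarith
  calc |r (h * g) - r g| = δ * |r (h * g) - r g| / δ := by field_simp
    _ ≤ 2 * p * dist h 1 * |r (h * g) - r g| / δ := by gcongr
    _ = 2 / δ * (p * |r (h * g) - r g|) * dist h 1 := by ring
    _ ≤ 2 / δ * (ε + D) * dist h 1 := by gcongr
end
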